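/- arXiv:2603.27270 — 4 statements merged into one kernel-verified Lean document; each statement's English description precedes it below -/
import Mathlib

section
/- Closed form for total uncertainty under total variation (Proposition 5, first identity): Let K ≥ 1 and let Q be a nonempty subset of the probability simplex Δ_{K-1}. Then ⨅ y : Fin K, sSup { d_TV(p, δ_y) : p ∈ Q } = 1 − ⨆ y : Fin K, sInf { p y : p ∈ Q }. -/
/-- The Dirac measure on `Fin K` at `y`, as a probability vector. -/
noncomputable def dirac {K : ℕ} (y : Fin K) : Fin K → ℝ := fun i => if i = y then 1 else 0

/-- The total variation distance on probability vectors over `Fin K`. -/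
noncomputable def dTV {K : ℕ} (p q : Fin K → ℝ) : ℝ := (1 / 2) * ∑ i, |p i - q i|

theorem dTV_dirac_eq {K : ℕ} (p : Fin K → ℝ) (hp : p ∈ stdSimplex ℝ (Fin K)) (y : Fin K) :
    dTV p (dirac y) = 1 - p y := by
  obtain ⟨h0, h1⟩ := hp
  have hle : p y ≤ 1 := by
    rw [← h1]
    exact Finset.single_le_sum (fun i _ => h0 i) (Finset.mem_univ y)
  have hs : ∀ i, |p i - dirac y i| = p i + (if i = y then 1 - 2 * p y else 0) := by
    intro i
    unfold dirac
    by_cases h : i = y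
    · subst h
      simp only [if_true]
      rw [abs_of_nonpos (by linarith)]
      ring
    · simp only [h, if_false, sub_zero, add_zero]
      exact abs_of_nonneg (h0 i)
  unfold dTV
  simp only [hs, Finset.sum_add_distrib, h1, Finset.sum_ite_eq', Finset.mem_univ, if_true]
  ring

/-- Closed form for total uncertainty under total variation:
`TU_TV(Q) = 1 − sup_y (lower probability of class y)`. -/
theorem tu_tv_closed_form (K : ℕ) (hK : 1 ≤ K)
    (Q : Set (Fin K → ℝ)) (hQne : Q.Nonempty) (hQ : Q ⊆ stdSimplex ℝ (Fin K)) :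
    (⨅ y : Fin K, sSup {x : ℝ | ∃ p ∈ Q, dTV p (dirac y) = x})
      = 1 - ⨆ y : Fin K, sInf {x : ℝ | ∃ p ∈ Q, p y = x} := by
  have : Nonempty (Fin K) := ⟨⟨0, hK⟩⟩
  have key : ∀ y : Fin K, sSup {x : ℝ | ∃ p ∈ Q, dTV p (dirac y) = x}
      = 1 - sInf {x : ℝ | ∃ p ∈ Q, p y = x} := by
    intro y
    obtain ⟨p0, hp0⟩ := hQne
    have hbb : BddBelow {x : ℝ | ∃ p ∈ Q, p y = x} := by
      refine ⟨0, ?_⟩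
      rintro x ⟨p, hp, rfl⟩
      exact (hQ hp).1 y
    have hba : BddAbove {x : ℝ | ∃ p ∈ Q, dTV p (dirac y) = x} := by
      refine ⟨1, ?_⟩
      rintro x ⟨p, hp, rfl⟩
      rw [dTV_dirac_eq p (hQ hp) y]
      linarith [(hQ hp).1 y]
    apply le_antisymm
    · refine csSup_le ⟨_, p0, hp0, rfl⟩ ?_
      rintro x ⟨p, hp, rfl⟩
      rw [dTV_dirac_eq p (hQ hp) y]
      linarith [csInf_le hbb ⟨p, hp, rfl⟩]
    · rw [sub_le_comm]
      refine le_csInf ⟨_, p0, hp0, rfl⟩ ?_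
      rintro x ⟨p, hp, rfl⟩
      have := le_csSup hba ⟨p, hp, rfl⟩
      rw [dTV_dirac_eq p (hQ hp) y] at this
      linarith
  simp only [key]
  apply le_antisymm
  · rw [le_sub_comm]
    apply ciSup_le
    intro y
    rw [le_sub_comm]
    exact ciInf_le (Set.finite_range _).bddBelow y
  · apply le_ciInf
    intro y
    have := le_ciSup (f := fun y : Fin K => sInf {x : ℝ | ∃ p ∈ Q, p y = x})
      (Set.finite_range _).bddAbove y
    linarith
end

section
/- Equivalence of the total-variation epistemic uncertainty with the maximum mean imprecision of the envelopes (Corollary 1): Let K ≥ 1 and let Q be a nonempty subset of the probability simplex Δ_{K-1}. Then (1/4) · sSup { ∑ i, |p i − q i| : p, q ∈ Q } = (1/2) · ⨆ A : Finset (Fin K), ( sSup { p(A) : p ∈ Q } − sInf { q(A) : q ∈ Q } ). -/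
lemma tv_le {K : ℕ} {p q : Fin K → ℝ} (hp : p ∈ stdSimplex ℝ (Fin K))
    (hq : q ∈ stdSimplex ℝ (Fin K)) (A : Finset (Fin K)) :
    2 * (∑ i ∈ A, p i - ∑ i ∈ A, q i) ≤ ∑ i, |p i - q i| := by
  have h1 := Finset.sum_add_sum_compl A p
  have h2 := Finset.sum_add_sum_compl A q
  have h3 := Finset.sum_add_sum_compl A (fun i => |p i - q i|)
  rw [hp.2] at h1
  rw [hq.2] at h2
  have h4 : ∑ i ∈ A, (p i - q i) ≤ ∑ i ∈ A, |p i - q i| :=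
    Finset.sum_le_sum fun i _ => le_abs_self _
  have h5 : ∑ i ∈ Aᶜ, (q i - p i) ≤ ∑ i ∈ Aᶜ, |p i - q i| :=
    Finset.sum_le_sum fun i _ => by rw [abs_sub_comm]; exact le_abs_self _
  rw [Finset.sum_sub_distrib] at h4 h5
  linarith

lemma tv_eq {K : ℕ} {p q : Fin K → ℝ} (hp : p ∈ stdSimplex ℝ (Fin K))
    (hq : q ∈ stdSimplex ℝ (Fin K)) :
    ∃ A : Finset (Fin K), ∑ i, |p i - q i| = 2 * (∑ i ∈ A, p i - ∑ i ∈ A, q i) := by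
  classical
  let A : Finset (Fin K) := Finset.univ.filter fun i => q i ≤ p i
  refine ⟨A, ?_⟩
  have h1 := Finset.sum_add_sum_compl A p
  have h2 := Finset.sum_add_sum_compl A q
  have h3 := Finset.sum_add_sum_compl A (fun i => |p i - q i|)
  rw [hp.2] at h1
  rw [hq.2] at h2
  have h4 : ∑ i ∈ A, |p i - q i| = ∑ i ∈ A, (p i - q i) :=
    Finset.sum_congr rfl fun i hi => abs_of_nonneg (by simp [A] at hi; linarith)
  have h5 : ∑ i ∈ Aᶜ, |p i - q i| = ∑ i ∈ Aᶜ, (q i - p i) :=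
    Finset.sum_congr rfl fun i hi => by
      rw [abs_of_nonpos (by simp [A] at hi; linarith)]; ring
  rw [Finset.sum_sub_distrib] at h4 h5
  linarith

lemma simplex_sum_le {K : ℕ} {p : Fin K → ℝ} (hp : p ∈ stdSimplex ℝ (Fin K))
    (A : Finset (Fin K)) : ∑ i ∈ A, p i ≤ 1 := by
  rw [← hp.2]
  exact Finset.sum_le_sum_of_subset_of_nonneg (Finset.subset_univ _) fun i _ _ => hp.1 i


/-- Equivalence of the total-variation epistemic uncertainty (a quarter of the
maximal ℓ1 diameter of `Q`) with half the maximum mean imprecision of the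
lower/upper probability envelopes. -/
theorem eu_tv_eq_mmi (K : ℕ) (hK : 1 ≤ K)
    (Q : Set (Fin K → ℝ)) (hQne : Q.Nonempty) (hQ : Q ⊆ stdSimplex ℝ (Fin K)) :
    (1 / 4) * sSup {x : ℝ | ∃ p ∈ Q, ∃ q ∈ Q, (∑ i, |p i - q i|) = x}
      = (1 / 2) * ⨆ A : Finset (Fin K),
          (sSup {x : ℝ | ∃ p ∈ Q, (∑ i ∈ A, p i) = x}
            - sInf {x : ℝ | ∃ q ∈ Q, (∑ i ∈ A, q i) = x}) := by
  obtain ⟨p0, hp0⟩ := hQne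
  have hb : BddAbove {x : ℝ | ∃ p ∈ Q, ∃ q ∈ Q, (∑ i, |p i - q i|) = x} := by
    refine ⟨2, ?_⟩
    rintro x ⟨p, hp, q, hq, rfl⟩
    obtain ⟨A, hA⟩ := tv_eq (hQ hp) (hQ hq)
    have h1 := simplex_sum_le (hQ hp) A
    have h2 : 0 ≤ ∑ i ∈ A, q i := Finset.sum_nonneg fun i _ => (hQ hq).1 i
    linarith
  have hbA : ∀ A : Finset (Fin K), BddAbove {x : ℝ | ∃ p ∈ Q, (∑ i ∈ A, p i) = x} := by
    intro A
    refine ⟨1, ?_⟩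
    rintro x ⟨p, hp, rfl⟩
    exact simplex_sum_le (hQ hp) A
  have hbB : ∀ A : Finset (Fin K), BddBelow {x : ℝ | ∃ q ∈ Q, (∑ i ∈ A, q i) = x} := by
    intro A
    refine ⟨0, ?_⟩
    rintro x ⟨p, hp, rfl⟩
    exact Finset.sum_nonneg fun i _ => (hQ hp).1 i
  apply le_antisymm
  · have : sSup {x : ℝ | ∃ p ∈ Q, ∃ q ∈ Q, (∑ i, |p i - q i|) = x} ≤
        2 * ⨆ A : Finset (Fin K), (sSup {x : ℝ | ∃ p ∈ Q, (∑ i ∈ A, p i) = x}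
            - sInf {x : ℝ | ∃ q ∈ Q, (∑ i ∈ A, q i) = x}) := by
      refine csSup_le ⟨_, p0, hp0, p0, hp0, rfl⟩ ?_
      rintro x ⟨p, hp, q, hq, rfl⟩
      obtain ⟨A, hA⟩ := tv_eq (hQ hp) (hQ hq)
      have h1 := le_csSup (hbA A) ⟨p, hp, rfl⟩
      have h2 := csInf_le (hbB A) ⟨q, hq, rfl⟩
      have h3 := le_ciSup (f := fun A : Finset (Fin K) =>
        (sSup {x : ℝ | ∃ p ∈ Q, (∑ i ∈ A, p i) = x}
            - sInf {x : ℝ | ∃ q ∈ Q, (∑ i ∈ A, q i) = x})) (Set.finite_range _).bddAbove A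
      linarith
    linarith
  · have : (⨆ A : Finset (Fin K), (sSup {x : ℝ | ∃ p ∈ Q, (∑ i ∈ A, p i) = x}
            - sInf {x : ℝ | ∃ q ∈ Q, (∑ i ∈ A, q i) = x})) ≤
        (1 / 2) * sSup {x : ℝ | ∃ p ∈ Q, ∃ q ∈ Q, (∑ i, |p i - q i|) = x} := by
      apply ciSup_le
      intro A
      rw [sub_le_iff_le_add]
      refine csSup_le ⟨_, p0, hp0, rfl⟩ ?_
      rintro x ⟨p, hp, rfl⟩
      rw [← sub_le_iff_le_add']
      refine le_csInf ⟨_, p0, hp0, rfl⟩ ?_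
      rintro x ⟨q, hq, rfl⟩
      have h1 := le_csSup hb ⟨p, hp, q, hq, rfl⟩
      have h2 := tv_le (hQ hp) (hQ hq) A
      linarith
    linarith
end

section
/- The upper aleatoric endpoint under a shared argmax class (Proposition 6, second part): Let K ≥ 1 and let Q be a nonempty compact convex subset of the probability simplex Δ_{K-1}. Suppose there exists y⋆ : Fin K such that for every p ∈ Set.extremePoints ℝ Q and every y : Fin K, p y ≤ p y⋆. Then sSup { 1 − ⨆ y : Fin K, p y : p ∈ Q } = 1 − sInf { p y⋆ : p ∈ Q }. -/
/-- The upper aleatoric endpoint under total variation, when all extreme points share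
the same argmax class `y⋆`: it equals one minus the lower probability of `y⋆`. -/
theorem au_tv_upper_shared_argmax (K : ℕ) (hK : 1 ≤ K)
    (Q : Set (Fin K → ℝ)) (hQne : Q.Nonempty) (hQ : Q ⊆ stdSimplex ℝ (Fin K))
    (hQc : IsCompact Q) (hQconv : Convex ℝ Q) (ystar : Fin K)
    (hstar : ∀ p ∈ Set.extremePoints ℝ Q, ∀ y : Fin K, p y ≤ p ystar) :
    sSup {x : ℝ | ∃ p ∈ Q, (1 - ⨆ y : Fin K, p y) = x}
      = 1 - sInf {x : ℝ | ∃ p ∈ Q, p ystar = x} := by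
  have hall : ∀ p ∈ Q, ∀ y : Fin K, p y ≤ p ystar := by
    intro p hp y
    have hconv : Convex ℝ {q : Fin K → ℝ | q y ≤ q ystar} := by
      intro a ha b hb s t hs ht _
      simp only [Set.mem_setOf_eq, Pi.add_apply, Pi.smul_apply, smul_eq_mul] at *
      exact add_le_add (mul_le_mul_of_nonneg_left ha hs) (mul_le_mul_of_nonneg_left hb ht)
    have hclosed : IsClosed {q : Fin K → ℝ | q y ≤ q ystar} :=
      isClosed_le (continuous_apply y) (continuous_apply ystar)
    have hsub : closure (convexHull ℝ (Set.extremePoints ℝ Q)) ⊆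
        {q : Fin K → ℝ | q y ≤ q ystar} :=
      closure_minimal (convexHull_min (fun q hq => hstar q hq y) hconv) hclosed
    rw [closure_convexHull_extremePoints hQc hQconv] at hsub
    exact hsub hp
  have hsup : ∀ p ∈ Q, (⨆ y : Fin K, p y) = p ystar := by
    intro p hp
    haveI : Nonempty (Fin K) := ⟨ystar⟩
    exact le_antisymm (ciSup_le (hall p hp))
      (le_ciSup (Set.finite_range p).bddAbove ystar)
  obtain ⟨m, hm, hmin⟩ := hQc.exists_isMinOn hQne (continuous_apply ystar).continuousOn
  have hmin' : ∀ p ∈ Q, m ystar ≤ p ystar := fun p hp => hmin hp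
  have h1 : IsLeast {x : ℝ | ∃ p ∈ Q, p ystar = x} (m ystar) := by
    refine ⟨⟨m, hm, rfl⟩, ?_⟩
    rintro _ ⟨p, hp, rfl⟩
    exact hmin' p hp
  have h2 : IsGreatest {x : ℝ | ∃ p ∈ Q, (1 - ⨆ y : Fin K, p y) = x} (1 - m ystar) := by
    refine ⟨⟨m, hm, by rw [hsup m hm]⟩, ?_⟩
    rintro _ ⟨p, hp, rfl⟩
    rw [hsup p hp]
    linarith [hmin' p hp]
  rw [h1.csInf_eq, h2.csSup_eq]
end

section
/- Binary-case identities for the total variation instantiation (Proposition 7): Let Q be a nonempty subset of the probability simplex Δ_1 = stdSimplex ℝ (Fin 2), and set a = sInf { p 0 : p ∈ Q } and b = sSup { p 0 : p ∈ Q }. Then: (i) the total uncertainty satisfies ⨅ y : Fin 2, sSup { (1/2) · ∑ i, |p i − δ_y i| : p ∈ Q } = min (1 − a) b; (ii) the lower aleatoric endpoint satisfies sInf { 1 − ⨆ y : Fin 2, p y : p ∈ Q } = min a (1 − b); (iii) the epistemic uncertainty satisfies (1/4) · sSup { ∑ i, |p i − q i| : p, q ∈ Q } = (b − a) / 2; and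 consequently (iv) min (1 − a) b = min a (1 − b) + (b − a), i.e., TU_TV(Q) = lower-AU_TV(Q) + 2 · EU_TV(Q). -/
theorem fin2_iInf (f : Fin 2 → ℝ) : (⨅ y, f y) = min (f 0) (f 1) := by
  apply le_antisymm
  · exact le_min (ciInf_le (Set.finite_range f).bddBelow 0)
      (ciInf_le (Set.finite_range f).bddBelow 1)
  · refine le_ciInf fun y => ?_
    fin_cases y
    · exact min_le_left _ _
    · exact min_le_right _ _

theorem fin2_iSup (f : Fin 2 → ℝ) : (⨆ y, f y) = max (f 0) (f 1) := by
  apply le_antisymm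
  · refine ciSup_le fun y => ?_
    fin_cases y
    · exact le_max_left _ _
    · exact le_max_right _ _
  · exact max_le (le_ciSup (Set.finite_range f).bddAbove 0)
      (le_ciSup (Set.finite_range f).bddAbove 1)

/-- Binary-case identities for the total variation instantiation: with
`a = inf { p 0 : p ∈ Q }` and `b = sup { p 0 : p ∈ Q }`, the total uncertainty equals
`min (1−a) b`, the lower aleatoric endpoint equals `min a (1−b)`, the epistemic
uncertainty equals `(b−a)/2`, and `TU = lower-AU + 2·EU`. -/
theorem binary_tv_identities
    (Q : Set (Fin 2 → ℝ)) (hQne : Q.Nonempty) (hQ : Q ⊆ stdSimplex ℝ (Fin 2))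
    (a b : ℝ)
    (ha : a = sInf {x : ℝ | ∃ p ∈ Q, p 0 = x})
    (hb : b = sSup {x : ℝ | ∃ p ∈ Q, p 0 = x}) :
    (⨅ y : Fin 2, sSup {x : ℝ | ∃ p ∈ Q, (1 / 2) * (∑ i, |p i - dirac y i|) = x})
        = min (1 - a) b
      ∧ sInf {x : ℝ | ∃ p ∈ Q, (1 - ⨆ y : Fin 2, p y) = x} = min a (1 - b)
      ∧ (1 / 4) * sSup {x : ℝ | ∃ p ∈ Q, ∃ q ∈ Q, (∑ i, |p i - q i|) = x} = (b - a) / 2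
      ∧ min (1 - a) b = min a (1 - b) + (b - a) := by
  have hs : ∀ p ∈ Q, 0 ≤ p 0 ∧ 0 ≤ p 1 ∧ p 1 = 1 - p 0 := by
    intro p hp
    obtain ⟨h1, h2⟩ := hQ hp
    rw [Fin.sum_univ_two] at h2
    exact ⟨h1 0, h1 1, by linarith⟩
  obtain ⟨p₀, hp₀⟩ := hQne
  have hne : {x : ℝ | ∃ p ∈ Q, p 0 = x}.Nonempty := ⟨_, p₀, hp₀, rfl⟩
  have hbb : BddBelow {x : ℝ | ∃ p ∈ Q, p 0 = x} := by
    refine ⟨0, ?_⟩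
    rintro x ⟨p, hp, rfl⟩
    exact (hs p hp).1
  have hba : BddAbove {x : ℝ | ∃ p ∈ Q, p 0 = x} := by
    refine ⟨1, ?_⟩
    rintro x ⟨p, hp, rfl⟩
    have := hs p hp
    linarith
  have hal : ∀ p ∈ Q, a ≤ p 0 := fun p hp => ha ▸ csInf_le hbb ⟨p, hp, rfl⟩
  have hbl : ∀ p ∈ Q, p 0 ≤ b := fun p hp => hb ▸ le_csSup hba ⟨p, hp, rfl⟩
  have hag : ∀ w, a < w → ∃ p ∈ Q, p 0 < w := by
    intro w hw
    rw [ha] at hw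
    obtain ⟨x, ⟨p, hp, rfl⟩, hx⟩ := exists_lt_of_csInf_lt hne hw
    exact ⟨p, hp, hx⟩
  have hbg : ∀ w, w < b → ∃ p ∈ Q, w < p 0 := by
    intro w hw
    rw [hb] at hw
    obtain ⟨x, ⟨p, hp, rfl⟩, hx⟩ := exists_lt_of_lt_csSup hne hw
    exact ⟨p, hp, hx⟩
  clear ha hb
  have d0 : ∀ p ∈ Q, (1 / 2) * (∑ i, |p i - dirac 0 i|) = 1 - p 0 := by
    intro p hp
    obtain ⟨h0, h1, h2⟩ := hs p hp
    have e : |p 0 - 1| = 1 - p 0 := by rw [abs_of_nonpos] <;> linarith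
    simp [Fin.sum_univ_two, dirac, e, abs_of_nonneg h1]
    linarith
  have d1 : ∀ p ∈ Q, (1 / 2) * (∑ i, |p i - dirac 1 i|) = p 0 := by
    intro p hp
    obtain ⟨h0, h1, h2⟩ := hs p hp
    have e : |p 1 - 1| = p 0 := by rw [abs_of_nonpos] <;> linarith
    simp [Fin.sum_univ_two, dirac, e, abs_of_nonneg h0]
    linarith
  have au : ∀ p ∈ Q, (1 - ⨆ y : Fin 2, p y) = min (p 0) (1 - p 0) := by
    intro p hp
    obtain ⟨h0, h1, h2⟩ := hs p hp
    rw [fin2_iSup, h2]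
    grind
  have dd : ∀ p ∈ Q, ∀ q ∈ Q, (∑ i, |p i - q i|) = 2 * |p 0 - q 0| := by
    intro p hp q hq
    rw [Fin.sum_univ_two, (hs p hp).2.2, (hs q hq).2.2]
    grind
  refine ⟨?_, ?_, ?_, ?_⟩
  · rw [fin2_iInf]
    congr 1
    · refine csSup_eq_of_forall_le_of_forall_lt_exists_gt ⟨_, p₀, hp₀, rfl⟩ ?_ ?_
      · rintro x ⟨p, hp, rfl⟩
        rw [d0 p hp]
        linarith [hal p hp]
      · intro w hw
        obtain ⟨p, hp, h⟩ := hag (1 - w) (by linarith)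
        exact ⟨_, ⟨p, hp, rfl⟩, by rw [d0 p hp]; linarith⟩
    · refine csSup_eq_of_forall_le_of_forall_lt_exists_gt ⟨_, p₀, hp₀, rfl⟩ ?_ ?_
      · rintro x ⟨p, hp, rfl⟩
        rw [d1 p hp]
        exact hbl p hp
      · intro w hw
        obtain ⟨p, hp, h⟩ := hbg w hw
        exact ⟨_, ⟨p, hp, rfl⟩, by rw [d1 p hp]; exact h⟩
  · refine csInf_eq_of_forall_ge_of_forall_gt_exists_lt ⟨_, p₀, hp₀, rfl⟩ ?_ ?_
    · rintro x ⟨p, hp, rfl⟩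
      rw [au p hp]
      exact min_le_min (hal p hp) (by linarith [hbl p hp])
    · intro w hw
      rcases min_lt_iff.1 hw with h | h
      · obtain ⟨p, hp, h⟩ := hag w h
        exact ⟨_, ⟨p, hp, rfl⟩, by rw [au p hp]; exact min_lt_of_left_lt h⟩
      · obtain ⟨p, hp, h⟩ := hbg (1 - w) (by linarith)
        exact ⟨_, ⟨p, hp, rfl⟩, by
          rw [au p hp]; exact min_lt_of_right_lt (by linarith)⟩
  · have : sSup {x : ℝ | ∃ p ∈ Q, ∃ q ∈ Q, (∑ i, |p i - q i|) = x} = 2 * (b - a) := by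
      refine csSup_eq_of_forall_le_of_forall_lt_exists_gt ⟨_, p₀, hp₀, p₀, hp₀, rfl⟩ ?_ ?_
      · rintro x ⟨p, hp, q, hq, rfl⟩
        rw [dd p hp q hq]
        have : |p 0 - q 0| ≤ b - a := abs_le.2
          ⟨by linarith [hal p hp, hbl q hq], by linarith [hal q hq, hbl p hp]⟩
        linarith
      · intro w hw
        obtain ⟨p, hp, h⟩ := hbg (b - (2 * (b - a) - w) / 4) (by linarith)
        obtain ⟨q, hq, h'⟩ := hag (a + (2 * (b - a) - w) / 4) (by linarith)
        refine ⟨_, ⟨p, hp, q, hq, rfl⟩, ?_⟩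
        rw [dd p hp q hq]
        linarith [le_abs_self (p 0 - q 0)]
    rw [this]
    ring
  · grind
end
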